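/- In every stochastic game, for every ε > 0 and every player i ∈ I there exists a bounded function D_i^ε : H → ℝ (a Martin function for the maxmin value) such that: (1) v_i(h) − ε ≤ D_i^ε(h) ≤ v_i(h) for every history h ∈ H, where v_i denotes the maxmin value; (2) D_i^ε(h) ≤ v_{O,i}(D_i^ε,h) for every history h ∈ H; and (3) for every history h' ∈ H and every strategy profile σ, if v_{O,i}(D_i^ε,h) ≤ E[D_i^ε | h, σ(h)] for every history h extending h' (including h'), then v_{O,i}(D_i^ε,h) ≤ E_{h,σ}[f_i] for every history h extending h' (including h'). -/

import Mathlib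

open scoped ENNReal NNReal Classical

/-- A multiplayer stochastic game: a nonempty finite set of players `I`, a nonempty
countable set of states `S`, nonempty finite action sets `A i`, a transition function
`trans` and bounded Borel payoff functions `payoff i` on runs. -/
structure StochGame where
  I : Type
  S : Type
  A : I → Type
  [fintypeI : Fintype I]
  [nonemptyI : Nonempty I]
  [countableS : Countable S]
  [nonemptyS : Nonempty S]
  [fintypeA : ∀ i, Fintype (A i)]
  [nonemptyA : ∀ i, Nonempty (A i)]
  trans : S → (∀ i, A i) → PMF S
  payoff : I → S × (ℕ → (∀ i, A i) × S) → ℝ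

open MeasureTheory

attribute [instance] StochGame.fintypeI StochGame.nonemptyI StochGame.countableS
  StochGame.nonemptyS StochGame.fintypeA StochGame.nonemptyA

namespace StochGame

variable (G : StochGame)

noncomputable instance : DecidableEq G.I := Classical.decEq _

noncomputable instance (i : G.I) : DecidableEq (G.A i) := Classical.decEq _

/-- Action profiles. -/
abbrev ActionProfile := ∀ i, G.A i

/-- Runs `(s¹,a¹,s²,a²,…)`, encoded as an initial state together with a sequence of
(action profile, next state) pairs. -/
abbrev Run := G.S × (ℕ → G.ActionProfile × G.S)

/-- Histories `(s¹,a¹,…,s^n)`, encoded as an initial state together with a finite list of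
(action profile, next state) pairs. -/
abbrev History := G.S × List (G.ActionProfile × G.S)

instance : MeasurableSpace G.S := ⊤
instance : MeasurableSpace G.ActionProfile := ⊤

variable {G}

/-- The final state `s_h` of a history. -/
def lastState (h : G.History) : G.S := h.2.getLast?.elim h.1 Prod.snd

/-- The stage (length) of a history: a history `(s¹,a¹,…,s^n)` is in stage `n`. -/
def stage (h : G.History) : ℕ := h.2.length + 1

/-- The history obtained by appending one action profile and one state. -/
def snocH (h : G.History) (a : G.ActionProfile) (s : G.S) : G.History :=
  (h.1, h.2 ++ [(a, s)])

/-- The history obtained by appending a finite list of (action profile, state) pairs. -/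
def catH (h : G.History) (l : List (G.ActionProfile × G.S)) : G.History := (h.1, h.2 ++ l)

/-- The history in stage 1 consisting of the initial state `s` only. -/
def initH (G : StochGame) (s : G.S) : G.History := (s, [])

/-- All transitions along the list have positive probability when starting from `s`. -/
def ValidFrom (G : StochGame) : G.S → List (G.ActionProfile × G.S) → Prop
  | _, [] => True
  | s, (a, t) :: l => G.trans s a t ≠ 0 ∧ ValidFrom G t l

/-- A history belongs to the set `H` of histories of the game iff all its transitions have
positive probability. -/
def Valid (h : G.History) : Prop := ValidFrom G h.1 h.2

/-- `Ext h h'` means that the history `h'` extends the history `h` (possibly `h = h'`),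
written `h ⪯ h'` in the paper. -/
def Ext (h h' : G.History) : Prop := h.1 = h'.1 ∧ h.2 <+: h'.2

/-- A behavior strategy of player `i`: a mixed action at every history. -/
abbrev Strategy (G : StochGame) (i : G.I) := G.History → PMF (G.A i)

/-- A strategy profile: one behavior strategy for each player. -/
abbrev Profile (G : StochGame) := ∀ i, G.Strategy i

/-- The probability, under the strategy profile `σ`, that after the history `h` play continues
exactly along the finite continuation `l`. -/
noncomputable def contProb (σ : G.Profile) : G.History → List (G.ActionProfile × G.S) → ℝ≥0∞
  | _, [] => 1
  | h, (a, s) :: l =>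
      (∏ i, σ i h (a i)) * G.trans (lastState h) a s * contProb σ (snocH h a s) l

/-- The cylinder set `C(h)` of all runs extending the history `h`. -/
def cyl (h : G.History) : Set G.Run :=
  {r | r.1 = h.1 ∧ ∀ k, (hk : k < h.2.length) → r.2 k = h.2.get ⟨k, hk⟩}

/-- `P` is the family of probability measures `P_{h,σ}` on runs induced, via the
Ionescu-Tulcea/Kolmogorov extension, by a history `h` and a strategy profile `σ`:
each `P h σ` is a probability measure, and the measure of the cylinder set of any finite
extension of `h` is the product of the transition probabilities prescribed by `σ` and `p`.
(These properties determine `P h σ` uniquely, since `P h σ (cyl h) = 1`.) -/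
def IsInducedFamily (G : StochGame) (P : G.History → G.Profile → Measure G.Run) : Prop :=
  (∀ h σ, IsProbabilityMeasure (P h σ)) ∧
    ∀ (h : G.History) (σ : G.Profile) (l : List (G.ActionProfile × G.S)),
      P h σ (cyl (catH h l)) = contProb σ h l

/-- The expected payoff `E_{h,σ}[f_i]` of player `i` in the subgame at `h` under `σ`. -/
noncomputable def expPay (P : G.History → G.Profile → Measure G.Run) (h : G.History)
    (σ : G.Profile) (i : G.I) : ℝ :=
  ∫ r, G.payoff i r ∂(P h σ)

/-- The minmax value `v̄_i(h)` of player `i` at the history `h`. -/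
noncomputable def minmaxVal (P : G.History → G.Profile → Measure G.Run) (i : G.I)
    (h : G.History) : ℝ :=
  ⨅ σ : G.Profile, ⨆ τ : G.Strategy i, expPay P h (Function.update σ i τ) i

/-- The maxmin value `v̲_i(h)` of player `i` at the history `h`. -/
noncomputable def maxminVal (P : G.History → G.Profile → Measure G.Run) (i : G.I)
    (h : G.History) : ℝ :=
  ⨆ τ : G.Strategy i, ⨅ σ : G.Profile, expPay P h (Function.update σ i τ) i

/-- `E[D | h, x]`: the expected value of `D` at the next history, when at history `h` the
players use the mixed action profile `x` and the next state is drawn according to `p`. -/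
noncomputable def oneShotExp (D : G.History → ℝ) (h : G.History) (x : ∀ i, PMF (G.A i)) : ℝ :=
  ∑ a : G.ActionProfile, (∏ i, (x i (a i)).toReal) *
    ∑' s : G.S, (G.trans (lastState h) a s).toReal * D (snocH h a s)

/-- The minmax value `v̄_{O,i}(D,h)` of player `i` in the one-shot game `G_O(D,h)`. -/
noncomputable def oneShotMinmax (D : G.History → ℝ) (i : G.I) (h : G.History) : ℝ :=
  ⨅ x : ∀ j, PMF (G.A j), ⨆ y : PMF (G.A i), oneShotExp D h (Function.update x i y)

/-- The maxmin value `v̲_{O,i}(D,h)` of player `i` in the one-shot game `G_O(D,h)`. -/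
noncomputable def oneShotMaxmin (D : G.History → ℝ) (i : G.I) (h : G.History) : ℝ :=
  ⨆ y : PMF (G.A i), ⨅ x : ∀ j, PMF (G.A j), oneShotExp D h (Function.update x i y)

end StochGame

namespace StochGame

section Aux

open Filter Topology

set_option linter.unusedVariables false

variable {G : StochGame}

/-- The prefix of length `k` of a run. -/
def pref (r : G.Run) (k : ℕ) : G.History := (r.1, (List.range k).map r.2)

/-- The length of a history. -/
def lenH (h : G.History) : ℕ := h.2.length

theorem pref_succ (r : G.Run) (k : ℕ) :
    pref r (k + 1) = snocH (pref r k) (r.2 k).1 (r.2 k).2 := by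
  simp [pref, snocH, List.range_succ]

theorem lenH_pref (r : G.Run) (k : ℕ) : lenH (pref r k) = k := by
  simp [pref, lenH]

theorem lenH_snocH (h : G.History) (a : G.ActionProfile) (s : G.S) :
    lenH (snocH h a s) = lenH h + 1 := by
  simp [snocH, lenH]

theorem run_eq_of_pref {r r' : G.Run} (h : ∀ k, pref r k = pref r' k) : r = r' := by
  refine Prod.ext ?_ ?_
  · exact congrArg (fun h : G.History => h.1) (h 0)
  · funext k
    have h1 := congrArg (fun h : G.History => h.2[k]?) (h (k + 1))
    simpa [pref] using h1

theorem cyl_eq (h : G.History) : cyl h = {r | pref r (lenH h) = h} := by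
  ext r
  simp only [cyl, Set.mem_ofPred_eq, pref, lenH]
  constructor
  · rintro ⟨h1, h2⟩
    refine Prod.ext h1 ?_
    apply List.ext_getElem
    · simp
    · intro n h3 h4
      have := h2 n h4
      simpa using this
  · intro h1
    have h2 : (List.range h.2.length).map r.2 = h.2 := congrArg Prod.snd h1
    refine ⟨congrArg Prod.fst h1, fun k hk => ?_⟩
    have h3 := congrArg (fun l => l[k]?) h2
    simp [hk] at h3
    simpa using h3

theorem measurable_pref (k : ℕ) :
    @Measurable G.Run G.History _ ⊤ (fun r => pref r k) := by
  let _ : MeasurableSpace G.History := ⊤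
  have h1 : Measurable (fun r : G.Run => ((r.1, fun j : Fin k => r.2 j) : G.S × (Fin k → _))) := by
    fun_prop
  have h2 : Measurable (fun q : G.S × (Fin k → G.ActionProfile × G.S) =>
      ((q.1, List.ofFn q.2) : G.History)) := Measurable.of_discrete
  have h3 := h2.comp h1
  convert h3 using 2 with r
  simp [pref, List.ofFn_eq_map, ← List.map_coe_finRange_eq_range]

theorem measurable_comp_pref (φ : G.History → ℝ≥0∞) (k : ℕ) :
    Measurable (fun r : G.Run => φ (pref r k)) := by
  let _ : MeasurableSpace G.History := ⊤
  exact (measurable_from_top (f := φ)).comp (measurable_pref k)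

/-- One-step weight. -/
noncomputable def wt (x : ∀ j, PMF (G.A j)) (h : G.History) (p : G.ActionProfile × G.S) : ℝ≥0∞ :=
  (∏ j, x j (p.1 j)) * G.trans (lastState h) p.1 p.2

/-- One-step law. -/
noncomputable def stepM (x : ∀ j, PMF (G.A j)) (h : G.History) :
    Measure (G.ActionProfile × G.S) :=
  Measure.sum (fun p => wt x h p • Measure.dirac p)

/-- One-step expectation in `ℝ≥0∞`. -/
noncomputable def tr (x : ∀ j, PMF (G.A j)) (V : G.History → ℝ≥0∞) (h : G.History) : ℝ≥0∞ :=
  ∫⁻ p, V (snocH h p.1 p.2) ∂(stepM x h)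

theorem tr_eq_tsum (x : ∀ j, PMF (G.A j)) (V : G.History → ℝ≥0∞) (h : G.History) :
    tr x V h = ∑' p, wt x h p * V (snocH h p.1 p.2) := by
  unfold tr stepM
  rw [lintegral_sum_measure]
  refine tsum_congr fun p => ?_
  rw [lintegral_smul_measure, lintegral_dirac]
  rfl

theorem sum_prod_pmf (x : ∀ j, PMF (G.A j)) :
    ∑ a : G.ActionProfile, ∏ j, x j (a j) = 1 := by
  have := Finset.prod_univ_sum (fun j => (Finset.univ : Finset (G.A j))) (fun j a => x j a)
  rw [Fintype.piFinset_univ] at this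
  rw [← this]
  refine Finset.prod_eq_one fun j _ => ?_
  rw [← tsum_fintype (L := .unconditional _)]
  exact (x j).tsum_coe

theorem tsum_wt (x : ∀ j, PMF (G.A j)) (h : G.History) : ∑' p, wt x h p = 1 := by
  rw [ENNReal.tsum_prod']
  simp only [wt, ENNReal.tsum_mul_left, PMF.tsum_coe, mul_one]
  rw [tsum_fintype, sum_prod_pmf]

theorem tr_const (x : ∀ j, PMF (G.A j)) (c : ℝ≥0∞) (h : G.History) :
    tr x (fun _ => c) h = c := by
  rw [tr_eq_tsum, ENNReal.tsum_mul_right, tsum_wt, one_mul]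

theorem tr_mono (x : ∀ j, PMF (G.A j)) {V W : G.History → ℝ≥0∞} {h : G.History}
    (hVW : ∀ a s, V (snocH h a s) ≤ W (snocH h a s)) : tr x V h ≤ tr x W h :=
  lintegral_mono fun p => hVW p.1 p.2

theorem tr_add (x : ∀ j, PMF (G.A j)) (V W : G.History → ℝ≥0∞) (h : G.History) :
    tr x (fun g => V g + W g) h = tr x V h + tr x W h :=
  lintegral_add_left Measurable.of_discrete _

theorem tr_mul (x : ∀ j, PMF (G.A j)) (c : ℝ≥0∞) (V : G.History → ℝ≥0∞) (h : G.History) :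
    tr x (fun g => c * V g) h = c * tr x V h :=
  lintegral_const_mul _ Measurable.of_discrete

theorem tr_tsum (x : ∀ j, PMF (G.A j)) (V : ℕ → G.History → ℝ≥0∞) (h : G.History) :
    tr x (fun g => ∑' n, V n g) h = ∑' n, tr x (V n) h :=
  lintegral_tsum fun _ => (Measurable.of_discrete).aemeasurable

theorem tr_iSup (x : ∀ j, PMF (G.A j)) (V : ℕ → G.History → ℝ≥0∞) (hV : Monotone V)
    (h : G.History) :
    tr x (fun g => ⨆ n, V n g) h = ⨆ n, tr x (V n) h :=
  lintegral_iSup (fun _ => Measurable.of_discrete) fun _ _ hmn p => hV hmn _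

theorem tr_iInf (x : ∀ j, PMF (G.A j)) (V : ℕ → G.History → ℝ≥0∞) (hV : Antitone V)
    (h : G.History) (hfin : tr x (V 0) h ≠ ⊤) :
    tr x (fun g => ⨅ n, V n g) h = ⨅ n, tr x (V n) h :=
  lintegral_iInf (fun _ => Measurable.of_discrete) (fun _ _ hmn p => hV hmn _) hfin

/-- Expectation operator of a strategy profile. -/
noncomputable def trS (σ : G.Profile) (V : G.History → ℝ≥0∞) (h : G.History) : ℝ≥0∞ :=
  tr (fun j => σ j h) V h

theorem trS_mono (σ : G.Profile) : Monotone (trS σ) :=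
  fun _ _ hVW _ => tr_mono _ fun _ _ => hVW _

theorem contProb_snoc (σ : G.Profile) (l : List (G.ActionProfile × G.S)) :
    ∀ (h : G.History) (p : G.ActionProfile × G.S),
    contProb σ h (l ++ [p]) = contProb σ h l * wt (fun j => σ j (catH h l)) (catH h l) p := by
  induction l with
  | nil => intro h p; simp [contProb, wt, catH]
  | cons q l ih =>
    intro h p
    obtain ⟨a, s⟩ := q
    have : catH (snocH h a s) l = catH h ((a, s) :: l) := by simp [catH, snocH]
    simp only [List.cons_append, contProb, ih, this, mul_assoc]

section Induced
variable {P : G.History → G.Profile → Measure G.Run}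

theorem measure_pref_zero (hP : IsInducedFamily G P) (h : G.History) (σ : G.Profile) (g : G.History) (k : ℕ)
    (hg : ¬ ∃ l, l.length = k ∧ g = catH h l) : P h σ {r | pref r (lenH h + k) = g} = 0 := by
  have := hP.1 h σ
  have h1 : P h σ (cyl h) = 1 := by
    have := hP.2 h σ []
    simpa [catH, contProb] using this
  have hm : MeasurableSet (cyl h) := by
    rw [cyl_eq]
    let _ : MeasurableSpace G.History := ⊤
    exact measurable_pref (lenH h) (MeasurableSpace.measurableSet_top (s := {h}))
  refine measure_mono_null (t := (cyl h)ᶜ) ?_ ((prob_compl_eq_zero_iff hm).2 h1)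
  intro r hr hc
  apply hg
  rw [cyl_eq] at hc
  simp only [Set.mem_ofPred_eq] at hr hc
  refine ⟨(List.range k).map (fun j => r.2 (lenH h + j)), by simp, ?_⟩
  rw [← hr]
  conv_rhs => rw [← hc]
  simp [catH, pref, List.range_add]
  simp [lenH]

theorem measure_pref_step (hP : IsInducedFamily G P) (h : G.History) (σ : G.Profile) (k : ℕ) (g : G.History)
    (p : G.ActionProfile × G.S) :
    P h σ {r | pref r (lenH h + k) = g ∧ r.2 (lenH h + k) = p}
      = P h σ {r | pref r (lenH h + k) = g} * wt (fun j => σ j g) g p := by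
  by_cases hg : ∃ l, l.length = k ∧ g = catH h l
  · obtain ⟨l, rfl, rfl⟩ := hg
    have e1 : {r : G.Run | pref r (lenH h + l.length) = catH h l} = cyl (catH h l) := by
      rw [cyl_eq]; simp [lenH, catH]
    have e2 : {r : G.Run | pref r (lenH h + l.length) = catH h l ∧ r.2 (lenH h + l.length) = p}
        = cyl (catH h (l ++ [p])) := by
      have e3 : lenH (catH h (l ++ [p])) = lenH h + l.length + 1 := by
        simp [lenH, catH]; omega
      have e4 : catH h (l ++ [p]) = snocH (catH h l) p.1 p.2 := by
        simp [catH, snocH]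
      rw [cyl_eq, e3]
      ext r
      simp only [Set.mem_ofPred_eq, pref_succ, e4]
      constructor
      · rintro ⟨h1, h2⟩; rw [h1, h2]
      · intro h1
        have h2 : (pref r (lenH h + l.length)).2 ++ [r.2 (lenH h + l.length)] = h.2 ++ l ++ [p] := by
          have := congrArg (fun h : G.History => h.2) h1
          simpa [snocH, catH] using this
        have h3 := List.append_inj' h2 rfl
        have h4 : (pref r (lenH h + l.length)).1 = (catH h l).1 := by
          have := congrArg (fun h : G.History => h.1) h1
          exact this
        exact ⟨Prod.ext h4 h3.1, by simpa using h3.2⟩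
    rw [e1, e2, hP.2, hP.2, contProb_snoc]
  · have h0 := measure_pref_zero hP h σ g k hg
    rw [h0, zero_mul]
    exact measure_mono_null (fun r hr => hr.1) h0

theorem lintegral_pref_succ (hP : IsInducedFamily G P) (h : G.History) (σ : G.Profile) (φ : G.History → ℝ≥0∞) (k : ℕ) :
    ∫⁻ r, φ (pref r (lenH h + k + 1)) ∂(P h σ)
      = ∫⁻ r, trS σ φ (pref r (lenH h + k)) ∂(P h σ) := by
  let _ : MeasurableSpace G.History := ⊤
  set n := lenH h + k with hn
  have m1 : Measurable (fun r : G.Run => (pref r n, r.2 n)) :=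
    (measurable_pref n).prodMk (by fun_prop)
  have m2 := measurable_pref (G := G) n
  have e1 : ∫⁻ r, φ (pref r (n + 1)) ∂(P h σ)
      = ∫⁻ q, φ (snocH q.1 q.2.1 q.2.2) ∂((P h σ).map (fun r : G.Run => (pref r n, r.2 n))) := by
    rw [lintegral_map Measurable.of_discrete m1]
    simp only [pref_succ]
  have e2 : ∫⁻ r, trS σ φ (pref r n) ∂(P h σ)
      = ∫⁻ g, trS σ φ g ∂((P h σ).map (fun r : G.Run => pref r n)) := by
    rw [lintegral_map measurable_from_top m2]
  rw [e1, e2, lintegral_countable', lintegral_countable', ENNReal.tsum_prod']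
  refine tsum_congr fun g => ?_
  unfold trS
  rw [tr_eq_tsum, ← ENNReal.tsum_mul_right]
  refine tsum_congr fun p => ?_
  rw [Measure.map_apply m1 (measurableSet_singleton _),
    Measure.map_apply m2 (measurableSet_singleton _)]
  have := measure_pref_step hP h σ k g p
  have e3 : (fun r : G.Run => (pref r n, r.2 n)) ⁻¹' {(g, p)}
     = {r | pref r (lenH h + k) = g ∧ r.2 (lenH h + k) = p} := by
    ext r; simp [n]
  have e4 : (fun r : G.Run => pref r n) ⁻¹' {g} = {r | pref r (lenH h + k) = g} := by
    ext r; simp [n]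
  rw [e3, e4, this]
  ring

theorem lintegral_pref (hP : IsInducedFamily G P) (h : G.History) (σ : G.Profile) (k : ℕ) :
    ∀ (φ : G.History → ℝ≥0∞), ∫⁻ r, φ (pref r (lenH h + k)) ∂(P h σ) = (trS σ)^[k] φ h := by
  have := hP.1 h σ
  induction k with
  | zero =>
    intro φ
    have hae : ∀ᵐ r ∂(P h σ), pref r (lenH h + 0) = h := by
      have h1 : P h σ (cyl h) = 1 := by
        have := hP.2 h σ []
        simpa [catH, contProb] using this
      have hm : MeasurableSet (cyl h) := by
        rw [cyl_eq]
        let _ : MeasurableSpace G.History := ⊤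
        exact measurable_pref (lenH h) (MeasurableSpace.measurableSet_top (s := {h}))
      have := (prob_compl_eq_zero_iff hm).2 h1
      rw [cyl_eq] at this
      exact this
    rw [lintegral_congr_ae (g := fun _ => φ h) (hae.mono fun r hr => by simp only [hr])]
    simp
  | succ k ih =>
    intro φ
    rw [Function.iterate_succ_apply, ← ih, ← lintegral_pref_succ hP, add_assoc]

/-- Supermartingale bound. -/
theorem lintegral_le_of_super (hP : IsInducedFamily G P) (h : G.History) (σ : G.Profile) (Y : G.History → ℝ≥0∞)
    (hY : ∀ g, trS σ Y g ≤ Y g) (F : G.Run → ℝ≥0∞)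
    (hF : ∀ r, F r ≤ liminf (fun k => Y (pref r k)) atTop) :
    ∫⁻ r, F r ∂(P h σ) ≤ trS σ Y h := by
  have hle : ∀ k, (trS σ)^[k] (trS σ Y) h ≤ trS σ Y h := by
    intro k
    induction k with
    | zero => exact le_rfl
    | succ k ih =>
      rw [Function.iterate_succ_apply]
      exact le_trans ((trS_mono σ).iterate k (trS_mono σ hY) h) ih
  have hsh : ∀ r : G.Run, liminf (fun k => Y (pref r k)) atTop
      = liminf (fun k => Y (pref r (lenH h + (k + 1)))) atTop := by
    intro r
    rw [← Filter.liminf_nat_add (fun k => Y (pref r k)) (lenH h + 1)]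
    congr 1
    funext k
    congr 2
    omega
  calc ∫⁻ r, F r ∂(P h σ)
      ≤ ∫⁻ r, liminf (fun k => Y (pref r (lenH h + (k + 1)))) atTop ∂(P h σ) :=
        lintegral_mono fun r => (hF r).trans (hsh r).le
    _ ≤ liminf (fun k => ∫⁻ r, Y (pref r (lenH h + (k + 1))) ∂(P h σ)) atTop :=
        lintegral_liminf_le fun k => measurable_comp_pref _ _
    _ = liminf (fun k => (trS σ)^[k] (trS σ Y) h) atTop := by
        simp only [lintegral_pref hP, Function.iterate_succ_apply]
    _ ≤ trS σ Y h := by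
        refine (liminf_le_liminf (Eventually.of_forall hle)).trans ?_
        simp

/-- Submartingale bound. -/
theorem le_lintegral_of_sub (hP : IsInducedFamily G P) (h : G.History) (σ : G.Profile) (W : G.History → ℝ≥0∞) (M : ℝ≥0∞)
    (hM : M ≠ ⊤) (hWM : ∀ g, W g ≤ M)
    (hW : ∀ g, W g ≤ trS σ W g) (F : G.Run → ℝ≥0∞)
    (hF : ∀ r, limsup (fun k => W (pref r k)) atTop ≤ F r) :
    W h ≤ ∫⁻ r, F r ∂(P h σ) := by
  have := hP.1 h σ
  have hle : ∀ k, W h ≤ (trS σ)^[k] W h := by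
    intro k
    induction k with
    | zero => exact le_rfl
    | succ k ih =>
      rw [Function.iterate_succ_apply]
      exact le_trans ih ((trS_mono σ).iterate k hW h)
  have hsh : ∀ r : G.Run, limsup (fun k => W (pref r k)) atTop
      = limsup (fun k => W (pref r (lenH h + k))) atTop := by
    intro r
    rw [← Filter.limsup_nat_add (fun k => W (pref r k)) (lenH h)]
    congr 1
    funext k
    congr 2
    omega
  calc W h ≤ limsup (fun k => (trS σ)^[k] W h) atTop := by
        refine le_trans ?_ (limsup_le_limsup (Eventually.of_forall hle))
        simp
    _ = limsup (fun k => ∫⁻ r, W (pref r (lenH h + k)) ∂(P h σ)) atTop := by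
        simp only [lintegral_pref hP]
    _ ≤ ∫⁻ r, limsup (fun k => W (pref r (lenH h + k))) atTop ∂(P h σ) := by
        refine limsup_lintegral_le (fun _ => M) (fun k => measurable_comp_pref _ _)
          (fun k => Eventually.of_forall fun r => hWM _) ?_
        simpa using hM
    _ ≤ ∫⁻ r, F r ∂(P h σ) := lintegral_mono fun r => (hsh r).symm.le.trans (hF r)

end Induced

/-- State of the switching construction: current history and index of the current function. -/
noncomputable def curSt (Vf : G.History → G.History → ℝ≥0∞) (v : G.History → ℝ≥0∞) (η : ℝ≥0∞)
    (h : G.History) : G.History × G.History × ℕ :=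
  h.2.foldl (fun q p => (snocH q.1 p.1 p.2,
    if v q.1 + 2 * η < Vf q.2.1 q.1 then (q.1, q.2.2 + 1) else q.2)) ((h.1, []), (h.1, []), 0)

theorem curSt_fst (Vf : G.History → G.History → ℝ≥0∞) (v : G.History → ℝ≥0∞) (η : ℝ≥0∞)
    (h : G.History) : (curSt Vf v η h).1 = h := by
  obtain ⟨s, l⟩ := h
  induction l using List.reverseRecOn with
  | nil => rfl
  | append_singleton l p ih =>
    unfold curSt at ih ⊢
    simp only [List.foldl_append, List.foldl_cons, List.foldl_nil] at ih ⊢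
    rw [ih]
    simp [snocH]

theorem curSt_snd (Vf : G.History → G.History → ℝ≥0∞) (v : G.History → ℝ≥0∞) (η : ℝ≥0∞)
    (h : G.History) (a : G.ActionProfile) (s : G.S) : (curSt Vf v η (snocH h a s)).2 =
      if v h + 2 * η < Vf (curSt Vf v η h).2.1 h then (h, (curSt Vf v η h).2.2 + 1)
      else (curSt Vf v η h).2 := by
  have h1 := curSt_fst Vf v η h
  unfold curSt at h1 ⊢
  simp only [snocH, List.foldl_append, List.foldl_cons, List.foldl_nil] at h1 ⊢
  rw [h1]
  congr

/-- Gluing of excessive functions by switching. -/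
theorem glue (Q : G.History → (G.History → ℝ≥0∞) → ℝ≥0∞ → Prop)
    (hQ : ∀ h U U' c, (∀ a s, U' (snocH h a s) ≤ U (snocH h a s)) → Q h U c → Q h U' c)
    (F : G.Run → ℝ≥0∞) (v : G.History → ℝ≥0∞) (η : ℝ≥0∞) (hη : η ≠ 0)
    (hV : ∀ h, ∃ V : G.History → ℝ≥0∞, (∀ g, Q g V (V g)) ∧
      (∀ r, F r ≤ liminf (fun k => V (pref r k)) atTop) ∧ V h ≤ v h + η ∧ ∀ g, v g ≤ V g) :
    ∃ (E : G.History → ℝ≥0∞) (sw : G.History → ℕ) (N : G.History → ℕ),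
      (∀ h, v h ≤ E h ∧ E h ≤ v h + 4 * η) ∧
      (∀ h a s, N (snocH h a s) = N h + sw h) ∧
      (∀ h, ∃ c, Q h E c ∧ c + sw h * η ≤ E h) ∧
      (∀ c : ℝ≥0∞, c ≠ 0 → ∀ r, F r ≤ liminf (fun k => E (pref r k) + c * N (pref r k)) atTop) := by
  choose Vf h1 h2 h3 h4 using hV
  set cur : G.History → G.History := fun h => (curSt Vf v η h).2.1 with hcur
  set N : G.History → ℕ := fun h => (curSt Vf v η h).2.2 with hN
  have hle24 : ∀ x : ℝ≥0∞, x + 2 * η ≤ x + 4 * η := fun x => by gcongr; norm_num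
  have cur_sw : ∀ h a s, v h + 2 * η < Vf (cur h) h → cur (snocH h a s) = h ∧
      N (snocH h a s) = N h + 1 := by
    intro h a s hs
    have := curSt_snd Vf v η h a s
    rw [if_pos hs] at this
    simp [hcur, hN, this]
  have cur_nsw : ∀ h a s, ¬ v h + 2 * η < Vf (cur h) h → cur (snocH h a s) = cur h ∧
      N (snocH h a s) = N h := by
    intro h a s hs
    have := curSt_snd Vf v η h a s
    rw [if_neg hs] at this
    simp [hcur, hN, this]
  refine ⟨fun h => min (Vf (cur h) h) (v h + 4 * η),
    fun h => if v h + 2 * η < Vf (cur h) h then 1 else 0, N, ?_, ?_, ?_, ?_⟩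
  · intro h
    exact ⟨le_min (h4 _ _) le_self_add, min_le_right _ _⟩
  · intro h a s
    beta_reduce
    split_ifs with hs
    · exact (cur_sw h a s hs).2
    · exact (cur_nsw h a s hs).2
  · intro h
    by_cases hs : v h + 2 * η < Vf (cur h) h
    · refine ⟨Vf h h, hQ h (Vf h) _ _ ?_ (h1 h h), ?_⟩
      · intro a s
        rw [(cur_sw h a s hs).1]
        exact min_le_left _ _
      · beta_reduce
        rw [if_pos hs]
        refine le_min (le_trans ?_ hs.le) (le_trans ?_ (hle24 _))
        all_goals
          push_cast
          rw [one_mul, two_mul, ← add_assoc]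
          gcongr
          exact h3 h
    · refine ⟨Vf (cur h) h, hQ h (Vf (cur h)) _ _ ?_ (h1 (cur h) h), ?_⟩
      · intro a s
        rw [(cur_nsw h a s hs).1]
        exact min_le_left _ _
      · beta_reduce
        rw [if_neg hs]
        simp only [Nat.cast_zero, zero_mul, add_zero]
        exact le_min le_rfl ((not_lt.1 hs).trans (hle24 _))
  · intro c hc r
    have hNmono : Monotone (fun k => N (pref r k)) := by
      refine monotone_nat_of_le_succ fun k => ?_
      rw [pref_succ]
      by_cases hs : v (pref r k) + 2 * η < Vf (cur (pref r k)) (pref r k)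
      · rw [(cur_sw _ _ _ hs).2]; omega
      · rw [(cur_nsw _ _ _ hs).2]
    by_cases hb : ∃ K, ∀ k, K ≤ k → ¬ v (pref r k) + 2 * η < Vf (cur (pref r k)) (pref r k)
    · obtain ⟨K, hK⟩ := hb
      have hcst : ∀ k, K ≤ k → cur (pref r k) = cur (pref r K) := by
        intro k hk
        induction k, hk using Nat.le_induction with
        | base => rfl
        | succ k hk ih => rw [pref_succ, (cur_nsw _ _ _ (hK k hk)).1, ih]
      refine (h2 (cur (pref r K)) r).trans (liminf_le_liminf ?_)
      filter_upwards [eventually_ge_atTop K] with k hk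
      refine le_trans (le_min ?_ ?_) le_self_add
      · rw [hcst k hk]
      · rw [← hcst k hk]
        exact (not_lt.1 (hK k hk)).trans (hle24 _)
    · push Not at hb
      have hT : Tendsto (fun k => N (pref r k)) atTop atTop := by
        refine tendsto_atTop_atTop_of_monotone hNmono fun b => ?_
        induction b with
        | zero => exact ⟨0, Nat.zero_le _⟩
        | succ b ih =>
          obtain ⟨k, hk⟩ := ih
          obtain ⟨m, hm, hs⟩ := hb k
          refine ⟨m + 1, ?_⟩
          have := hNmono hm
          rw [pref_succ, (cur_sw _ _ _ hs).2]
          simp only at this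
          omega
      have hT2 : Tendsto (fun k => c * (N (pref r k) : ℝ≥0∞)) atTop (𝓝 ⊤) := by
        have h5 : Tendsto (fun k => (N (pref r k) : ℝ≥0∞)) atTop (𝓝 ⊤) :=
          ENNReal.tendsto_nat_nhds_top.comp hT
        have h6 := ENNReal.Tendsto.const_mul (a := c) h5 (Or.inl ENNReal.top_ne_zero)
        rwa [ENNReal.mul_top hc] at h6
      have h7 : liminf (fun k => c * (N (pref r k) : ℝ≥0∞)) atTop = ⊤ := hT2.liminf_eq
      refine le_trans (le_top.trans h7.ge) (liminf_le_liminf ?_)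
      exact Eventually.of_forall fun k => le_add_self

/-- Excessive functions for the fixed strategy `τ` of player `i` dominating `F`. -/
def Exc (i : G.I) (τ : G.Strategy i) (F : G.Run → ℝ≥0∞) (V : G.History → ℝ≥0∞) : Prop :=
  (∀ h (x : ∀ j, PMF (G.A j)), tr (Function.update x i (τ h)) V h ≤ V h) ∧
    ∀ r, F r ≤ liminf (fun k => V (pref r k)) atTop

/-- The outer value. -/
noncomputable def outer (i : G.I) (τ : G.Strategy i) (F : G.Run → ℝ≥0∞) (h : G.History) : ℝ≥0∞ :=
  ⨅ (V : G.History → ℝ≥0∞) (_ : Exc i τ F V), V h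

theorem outer_le {i : G.I} {τ : G.Strategy i} {F : G.Run → ℝ≥0∞} {V : G.History → ℝ≥0∞}
    (hV : Exc i τ F V) (h : G.History) : outer i τ F h ≤ V h :=
  iInf₂_le V hV

theorem exists_outer_lt {i : G.I} {τ : G.Strategy i} {F : G.Run → ℝ≥0∞} {h : G.History}
    {c : ℝ≥0∞} (hc : outer i τ F h < c) : ∃ V, Exc i τ F V ∧ V h < c := by
  simpa [outer, iInf_lt_iff] using hc

theorem outer_mono (i : G.I) (τ : G.Strategy i) {F F' : G.Run → ℝ≥0∞} (hF : F ≤ F')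
    (h : G.History) : outer i τ F h ≤ outer i τ F' h :=
  le_iInf₂ fun V hV => outer_le ⟨hV.1, fun r => (hF r).trans (hV.2 r)⟩ h

theorem outer_le_const (i : G.I) (τ : G.Strategy i) {F : G.Run → ℝ≥0∞} {M : ℝ≥0∞}
    (hF : ∀ r, F r ≤ M) (h : G.History) : outer i τ F h ≤ M :=
  outer_le (V := fun _ => M) ⟨fun h x => (tr_const _ _ _).le, fun r => by simpa using hF r⟩ h

theorem tr_outer (i : G.I) (τ : G.Strategy i) (F : G.Run → ℝ≥0∞) (h : G.History)
    (x : ∀ j, PMF (G.A j)) : tr (Function.update x i (τ h)) (outer i τ F) h ≤ outer i τ F h :=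
  le_iInf₂ fun V hV => (tr_mono _ fun _ _ => outer_le hV _).trans (hV.1 h x)

/-- Strong approximation. -/
theorem outer_approx (i : G.I) (τ : G.Strategy i) (F : G.Run → ℝ≥0∞) (M : ℝ≥0∞) (hM : M ≠ ⊤)
    (hF : ∀ r, F r ≤ M) (h₀ : G.History) (ε : ℝ≥0∞) (hε : ε ≠ 0) :
    ∃ δ : G.History → ℝ≥0∞, δ h₀ ≤ ε ∧
      (∀ h (x : ∀ j, PMF (G.A j)), tr (Function.update x i (τ h)) δ h ≤ δ h) ∧
      ∀ r, F r ≤ liminf (fun k => outer i τ F (pref r k) + δ (pref r k)) atTop := by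
  wlog hεt : ε ≠ ⊤ generalizing ε
  · obtain ⟨δ, h1, h2⟩ := this 1 one_ne_zero ENNReal.one_ne_top
    refine ⟨δ, h1.trans ?_, h2⟩
    rw [not_not.1 hεt]; exact le_top
  set η := ε / 8 with hη
  have hη0 : η ≠ 0 := by simp [hη, hε]
  have hηt : η ≠ ⊤ := ENNReal.div_ne_top hεt (by norm_num)
  have h8 : 8 * η = ε := by
    rw [hη]; exact ENNReal.mul_div_cancel (by norm_num) (by norm_num)
  obtain ⟨E, sw, N, g1, g2, g3, g4⟩ := glue
    (fun h U c => ∀ x : ∀ j, PMF (G.A j), tr (Function.update x i (τ h)) U h ≤ c)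
    (fun h U U' c hU hc x => (tr_mono _ hU).trans (hc x)) F (outer i τ F) η hη0 (by
      intro h
      have hlt : outer i τ F h < outer i τ F h + η :=
        ENNReal.lt_add_right (ne_top_of_le_ne_top hM (outer_le_const i τ hF h)) hη0
      obtain ⟨V, hV, hVh⟩ := exists_outer_lt hlt
      exact ⟨V, hV.1, hV.2, hVh.le, outer_le hV⟩)
  set B : ℝ≥0∞ := E h₀ + η * N h₀ with hB
  have hEt : E h₀ ≠ ⊤ := by
    refine ne_top_of_le_ne_top ?_ (g1 h₀).2
    exact ENNReal.add_ne_top.2 ⟨ne_top_of_le_ne_top hM (outer_le_const i τ hF h₀),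
      ENNReal.mul_ne_top (by norm_num) hηt⟩
  have hBt : B ≠ ⊤ := ENNReal.add_ne_top.2 ⟨hEt, ENNReal.mul_ne_top hηt (by simp)⟩
  obtain ⟨c, hc0, hcB⟩ : ∃ c : ℝ≥0∞, c ≠ 0 ∧ c * B ≤ 4 * η := by
    refine ⟨4 * η / (B + 1), ?_, ?_⟩
    · simp [hη0, hBt]
    · calc 4 * η / (B + 1) * B ≤ 4 * η / (B + 1) * (B + 1) := by gcongr; exact le_self_add
        _ ≤ 4 * η := (ENNReal.div_mul_cancel (by simp) (by simp [hBt])).le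
  refine ⟨fun h => 4 * η + c * (E h + η * N h), ?_, ?_, ?_⟩
  · calc 4 * η + c * B ≤ 4 * η + 4 * η := by gcongr
      _ = 8 * η := by ring
      _ = ε := h8
      _ ≤ ε := le_rfl
  · intro h x
    rw [tr_add, tr_const, tr_mul, tr_add]
    beta_reduce
    refine add_le_add le_rfl (mul_le_mul' le_rfl ?_)
    obtain ⟨d, hd1, hd2⟩ := g3 h
    have e1 : tr (Function.update x i (τ h)) (fun g => η * (N g : ℝ≥0∞)) h
        ≤ η * (N h + sw h) := by
      rw [← tr_const (Function.update x i (τ h)) (η * (N h + sw h)) h]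
      refine tr_mono _ fun a s => ?_
      rw [g2]; push_cast; rfl
    calc tr (Function.update x i (τ h)) E h
          + tr (Function.update x i (τ h)) (fun g => η * (N g : ℝ≥0∞)) h
        ≤ d + η * (N h + sw h) := add_le_add (hd1 x) e1
      _ = (d + sw h * η) + η * N h := by ring
      _ ≤ E h + η * N h := by gcongr
  · intro r
    refine (g4 (c * η) (mul_ne_zero hc0 hη0) r).trans (liminf_le_liminf ?_)
    refine Eventually.of_forall fun k => ?_
    calc E (pref r k) + c * η * N (pref r k)
        ≤ (outer i τ F (pref r k) + 4 * η) + c * (E (pref r k) + η * N (pref r k)) := by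
          refine add_le_add (g1 _).2 ?_
          rw [mul_assoc]
          gcongr
          exact le_add_self
      _ = _ := by ring

/-- Continuity from below. -/
theorem outer_iSup (i : G.I) (τ : G.Strategy i) (F : ℕ → G.Run → ℝ≥0∞) (hmono : Monotone F)
    (M : ℝ≥0∞) (hM : M ≠ ⊤) (hF : ∀ n r, F n r ≤ M) (h₀ : G.History) :
    outer i τ (fun r => ⨆ n, F n r) h₀ ≤ ⨆ n, outer i τ (F n) h₀ := by
  refine ENNReal.le_of_forall_pos_le_add fun ε hε _ => ?_
  obtain ⟨ε', hε'0, hε's⟩ := ENNReal.exists_pos_sum_of_countable'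
    (ε := (ε : ℝ≥0∞)) (by simpa using hε.ne') ℕ
  choose δ hδ1 hδ2 hδ3 using fun n => outer_approx i τ (F n) M hM (hF n) h₀ (ε' n) (hε'0 n).ne'
  have hmo : Monotone (fun n => outer i τ (F n)) := fun m n hmn h => outer_mono i τ (hmono hmn) h
  have hV : Exc i τ (fun r => ⨆ n, F n r)
      (fun h => (⨆ n, outer i τ (F n) h) + ∑' n, δ n h) := by
    constructor
    · intro h x
      rw [tr_add, tr_tsum, tr_iSup _ (fun n => outer i τ (F n)) hmo]
      refine add_le_add (iSup_mono fun n => tr_outer i τ (F n) h x)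
        (ENNReal.tsum_le_tsum fun n => hδ2 n h x)
    · intro r
      refine iSup_le fun n => (hδ3 n r).trans (liminf_le_liminf (Eventually.of_forall fun k => ?_))
      exact add_le_add (le_iSup (fun n => outer i τ (F n) (pref r k)) n) (ENNReal.le_tsum n)
  refine (outer_le hV h₀).trans ?_
  gcongr
  exact (ENNReal.tsum_le_tsum hδ1).trans hε's.le

theorem exists_code (F : G.Run → ℝ≥0∞) (hF : Measurable F) :
    ∃ π : (ℕ → ℕ) → G.Run, Function.Surjective π ∧ Continuous (fun x => F (π x)) ∧
      ∀ k x, ∀ᶠ y in 𝓝 x, pref (π y) k = pref (π x) k := by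
  let _ : TopologicalSpace G.S := ⊥
  let _ : TopologicalSpace G.ActionProfile := ⊥
  have : DiscreteTopology G.S := ⟨rfl⟩
  have : DiscreteTopology G.ActionProfile := ⟨rfl⟩
  have : BorelSpace G.S := ⟨borel_eq_top_of_discrete.symm⟩
  have : BorelSpace G.ActionProfile := ⟨borel_eq_top_of_discrete.symm⟩
  have hcont : ∀ π : (ℕ → ℕ) → G.Run, Continuous π →
      ∀ k x, ∀ᶠ y in 𝓝 x, pref (π y) k = pref (π x) k := by
    intro π hπ'
    intro k x
    have h1 : Continuous (fun y => (((π y).1, fun j : Fin k => (π y).2 j) : G.S × (Fin k → _))) := by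
      fun_prop
    have h2 : ∀ᶠ y in 𝓝 x, (((π y).1, fun j : Fin k => (π y).2 j) : G.S × (Fin k → _))
        = ((π x).1, fun j : Fin k => (π x).2 j) :=
      h1.continuousAt.eventually (p := fun q => q = ((π x).1, fun j : Fin k => (π x).2 j))
        ((isOpen_discrete {((π x).1, fun j : Fin k => (π x).2 j)}).mem_nhds rfl)
    filter_upwards [h2] with y hy
    have e : ∀ r : G.Run, pref r k = (r.1, List.ofFn (fun j : Fin k => r.2 j)) := by
      intro r
      simp [pref, List.ofFn_eq_map, ← List.map_coe_finRange_eq_range]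
    rw [Prod.mk.injEq] at hy
    rw [e, e, hy.1, hy.2]
  obtain ⟨t', ht', hc, hp⟩ := hF.exists_continuous
  obtain ⟨π, hπ, hs⟩ := @PolishSpace.exists_nat_nat_continuous_surjective G.Run t' hp inferInstance
  exact ⟨π, hs, @Continuous.comp _ _ _ _ t' _ π F hc hπ,
    hcont π (@continuous_le_rng _ _ _ _ _ _ ht' hπ)⟩

theorem tr_eq_sum (x : ∀ j, PMF (G.A j)) (V : G.History → ℝ≥0∞) (h : G.History) :
    tr x V h = ∑ a : G.ActionProfile, (∏ j, x j (a j)) *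
      ∑' s, G.trans (lastState h) a s * V (snocH h a s) := by
  rw [tr_eq_tsum, ENNReal.tsum_prod', tsum_fintype]
  simp only [wt, mul_assoc, ENNReal.tsum_mul_left]

/-- A bound against pure opponents extends to mixed opponents. -/
theorem tr_le_of_pure (i : G.I) (y : PMF (G.A i)) (V : G.History → ℝ≥0∞) (h : G.History)
    (c : ℝ≥0∞)
    (hb : ∀ b : G.ActionProfile, tr (Function.update (fun j => PMF.pure (b j)) i y) V h ≤ c)
    (x : ∀ j, PMF (G.A j)) : tr (Function.update x i y) V h ≤ c := by
  have key : tr (Function.update x i y) V h = ∑ b : G.ActionProfile, (∏ j, x j (b j)) *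
      tr (Function.update (fun j => PMF.pure (b j)) i y) V h := by
    simp only [tr_eq_sum, Finset.mul_sum]
    rw [Finset.sum_comm]
    refine Finset.sum_congr rfl fun a _ => ?_
    simp only [← mul_assoc, ← Finset.prod_mul_distrib]
    rw [← Finset.sum_mul]
    congr 1
    have := Finset.prod_univ_sum (fun j => (Finset.univ : Finset (G.A j)))
      (fun j bj => x j bj * (if j = i then (Function.update x i y : ∀ j, PMF (G.A j)) j (a j)
        else (if a j = bj then 1 else 0)))
    rw [Fintype.piFinset_univ] at this
    trans ∏ j, ∑ bj, x j bj * (if j = i then (Function.update x i y : ∀ j, PMF (G.A j)) j (a j)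
        else (if a j = bj then 1 else 0))
    · refine Finset.prod_congr rfl fun j _ => ?_
      by_cases hj : j = i
      · subst hj
        simp only [Function.update_self, if_true]
        rw [← Finset.sum_mul, ← tsum_fintype (L := .unconditional _), (x j).tsum_coe, one_mul]
      · simp [hj]
    · rw [this]
      refine Finset.sum_congr rfl fun b _ => Finset.prod_congr rfl fun j _ => ?_
      congr 1
      by_cases hj : j = i
      · subst hj; simp
      · simp [hj, PMF.pure_apply]
  rw [key]
  calc ∑ b : G.ActionProfile, (∏ j, x j (b j)) *
      tr (Function.update (fun j => PMF.pure (b j)) i y) V h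
      ≤ ∑ b : G.ActionProfile, (∏ j, x j (b j)) * c :=
        Finset.sum_le_sum fun b _ => mul_le_mul' le_rfl (hb b)
    _ = c := by rw [← Finset.sum_mul, sum_prod_pmf, one_mul]

/-- Maximal one-step expectation over the opponents' pure actions. -/
noncomputable def mx (i : G.I) (τ : G.Strategy i) (U : G.History → ℝ≥0∞) (h : G.History) : ℝ≥0∞ :=
  ⨆ b : G.ActionProfile, tr (Function.update (fun j => PMF.pure (b j)) i (τ h)) U h

theorem mx_mono (i : G.I) (τ : G.Strategy i) : Monotone (mx i τ) :=
  fun _ _ hUV _ => iSup_mono fun _ => tr_mono _ fun _ _ => hUV _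

/-- Truncation of a history. -/
def takeH (n : ℕ) (h : G.History) : G.History := (h.1, h.2.take n)

theorem takeH_pref (r : G.Run) {n k : ℕ} (hnk : n ≤ k) : takeH n (pref r k) = pref r n := by
  simp [takeH, pref, ← List.map_take, List.take_range, hnk]

theorem takeH_of_le {n : ℕ} {h : G.History} (hn : lenH h ≤ n) : takeH n h = h := by
  unfold lenH at hn
  simp [takeH, List.take_of_length_le hn]

theorem takeH_snocH {n : ℕ} {h : G.History} (hn : n ≤ lenH h) (a : G.ActionProfile) (s : G.S) :
    takeH n (snocH h a s) = takeH n h := by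
  unfold lenH at hn
  simp [takeH, snocH, List.take_append_of_le_length hn]

/-- Finite horizon problems give excessive functions. -/
theorem exc_horizon (i : G.I) (τ : G.Strategy i) (g : G.History → ℝ≥0∞) (n : ℕ) (ε : ℝ≥0∞)
    (F : G.Run → ℝ≥0∞) (hF : ∀ r, F r ≤ g (pref r n) + ε) :
    Exc i τ F (fun h => (mx i τ)^[n - lenH h] g (takeH n h) + ε) := by
  constructor
  · intro h x
    rw [tr_add, tr_const]
    refine add_le_add ?_ le_rfl
    rcases lt_or_ge (lenH h) n with hn | hn
    · have e1 : n - lenH h = (n - (lenH h + 1)) + 1 := by omega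
      rw [takeH_of_le hn.le, e1, Function.iterate_succ_apply']
      refine tr_le_of_pure i _ _ _ _ (fun b => ?_) x
      refine le_trans (tr_mono _ fun a s => ?_) (le_iSup (fun b : G.ActionProfile =>
        tr (Function.update (fun j => PMF.pure (b j)) i (τ h))
          ((mx i τ)^[n - (lenH h + 1)] g) h) b)
      rw [lenH_snocH, takeH_of_le]
      rw [lenH_snocH]; omega
    · refine le_of_eq_of_le ?_ (tr_const (Function.update x i (τ h)) _ h).le
      rw [tr_eq_tsum, tr_eq_tsum]
      refine tsum_congr fun p => ?_
      rw [takeH_snocH hn, lenH_snocH]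
      have e1 : n - (lenH h + 1) = 0 := by omega
      have e2 : n - lenH h = 0 := by omega
      rw [e1, e2]
  · intro r
    have : (fun k => (mx i τ)^[n - lenH (pref r k)] g (takeH n (pref r k)) + ε)
        =ᶠ[atTop] fun _ => g (pref r n) + ε := by
      filter_upwards [eventually_ge_atTop n] with k hk
      rw [lenH_pref, takeH_pref r hk]
      have e1 : n - k = 0 := by omega
      rw [e1]; rfl
    rw [liminf_congr this]
    simpa using hF r

theorem isCompact_box (n : ℕ → ℕ) : IsCompact {x : ℕ → ℕ | ∀ j, x j ≤ n j} := by
  have : {x : ℕ → ℕ | ∀ j, x j ≤ n j} = Set.pi Set.univ (fun j => Set.Iic (n j)) := by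
    ext x; simp only [Set.mem_ofPred_eq, Set.mem_pi, Set.mem_univ, true_imp_iff, Set.mem_Iic]
  rw [this]
  exact isCompact_univ_pi fun j => (Set.finite_Iic (n j)).isCompact

theorem exists_box_subset (n : ℕ → ℕ) (U : Set (ℕ → ℕ)) (hU : IsOpen U)
    (hsub : ∀ x, (∀ j, x j ≤ n j) → x ∈ U) : ∃ k, ∀ x, (∀ j < k, x j ≤ n j) → x ∈ U := by
  by_contra hcon
  push Not at hcon
  choose x hx hxU using hcon
  -- truncate to the box
  set z : ℕ → ℕ → ℕ := fun k j => min (x k j) (n j) with hz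
  obtain ⟨w, hw, φ, hφ, hlim⟩ := (isCompact_box n).tendsto_subseq (x := z)
    (fun k j => min_le_right _ _)
  have hlim2 : Tendsto (fun k => x (φ k)) atTop (𝓝 w) := by
    rw [tendsto_pi_nhds] at hlim ⊢
    intro j
    refine (hlim j).congr' ?_
    filter_upwards [eventually_gt_atTop j] with k hk
    have : j < φ k := lt_of_lt_of_le hk (hφ.id_le k)
    simp [hz, hx (φ k) j this]
  have := hlim2.eventually (hU.mem_nhds (hsub w hw))
  obtain ⟨k, hk⟩ := this.exists
  exact hxU _ hk

section Cap
variable {P : G.History → G.Profile → Measure G.Run}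

/-- Capacitability: the outer value is approximated by actual strategies. -/
theorem outer_le_cost (hP : IsInducedFamily G P) (i : G.I) (τ : G.Strategy i) (F : G.Run → ℝ≥0∞) (hFm : Measurable F)
    (M : ℝ≥0∞) (hM : M ≠ ⊤) (hF : ∀ r, F r ≤ M) (h₀ : G.History) (a : ℝ≥0∞)
    (ha : a < outer i τ F h₀) :
    ∃ σ : G.Profile, a ≤ ∫⁻ r, F r ∂(P h₀ (Function.update σ i τ)) := by
  obtain ⟨π, hπs, hπF, hπc⟩ := exists_code F hFm
  -- restriction to a set of codes
  set R : Set (ℕ → ℕ) → G.Run → ℝ≥0∞ := fun B => (π '' B).indicator F with hR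
  have hRM : ∀ B r, R B r ≤ M := fun B r => (Set.indicator_le_self' (by simp) r).trans (hF r)
  have step : ∀ B : Set (ℕ → ℕ), ∀ k : ℕ, a < outer i τ (R B) h₀ →
      ∃ m, a < outer i τ (R (B ∩ {x | x k ≤ m})) h₀ := by
    intro B k hB
    have e1 : R B = fun r => ⨆ m, R (B ∩ {x | x k ≤ m}) r := by
      funext r
      apply le_antisymm
      · by_cases hr : r ∈ π '' B
        · obtain ⟨x, hx, rfl⟩ := hr
          refine le_trans ?_ (le_iSup _ (x k))
          simp only [hR]
          rw [Set.indicator_of_mem (Set.mem_image_of_mem π hx),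
            Set.indicator_of_mem (Set.mem_image_of_mem π (show x ∈ B ∩ {y | y k ≤ x k} from ⟨hx, le_refl (x k)⟩))]
        · simp [hR, Set.indicator_of_notMem hr]
      · refine iSup_le fun m => ?_
        exact Set.indicator_le_indicator_of_subset (Set.image_mono Set.inter_subset_left)
          (by simp) r
    have hmono : Monotone (fun m r => R (B ∩ {x | x k ≤ m}) r) := by
      intro m m' hmm r
      refine Set.indicator_le_indicator_of_subset (Set.image_mono ?_) (by simp) r
      rintro x ⟨h1, h2⟩
      exact ⟨h1, le_trans h2 hmm⟩
    have h1 := outer_iSup i τ _ hmono M hM (fun m r => hRM _ r) h₀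
    rw [← e1] at h1
    exact lt_iSup_iff.1 (lt_of_lt_of_le hB h1)
  -- recursive choice of the box
  have hstep' : ∀ (k : ℕ) (B : {B : Set (ℕ → ℕ) // a < outer i τ (R B) h₀}),
      ∃ m, a < outer i τ (R (B.1 ∩ {x | x k ≤ m})) h₀ := fun k B => step B.1 k B.2
  choose m hm using hstep'
  have h0 : a < outer i τ (R Set.univ) h₀ := by
    have : R Set.univ = F := by
      simp [hR, hπs.range_eq]
    rwa [this]
  let B : ℕ → {B : Set (ℕ → ℕ) // a < outer i τ (R B) h₀} := fun k =>
    Nat.rec ⟨Set.univ, h0⟩ (fun k Bk => ⟨Bk.1 ∩ {x | x k ≤ m k Bk}, hm k Bk⟩) k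
  set n : ℕ → ℕ := fun k => m k (B k) with hn
  have hB : ∀ k, (B k).1 = {x | ∀ j < k, x j ≤ n j} := by
    intro k
    induction k with
    | zero => ext x; simp [B]
    | succ k ih =>
      have : (B (k + 1)).1 = (B k).1 ∩ {x | x k ≤ n k} := rfl
      rw [this, ih]
      ext x
      simp only [Set.mem_inter_iff, Set.mem_ofPred_eq]
      constructor
      · rintro ⟨h1, h2⟩ j hj
        rcases Nat.lt_succ_iff_lt_or_eq.1 hj with h | rfl
        · exact h1 j h
        · exact h2
      · intro h1
        exact ⟨fun j hj => h1 j (by omega), h1 k (by omega)⟩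
  -- the upper envelope on histories
  set g : G.History → ℝ≥0∞ := fun h =>
    ⨆ (x : ℕ → ℕ) (_ : (∀ j, x j ≤ n j) ∧ pref (π x) (lenH h) = h), F (π x) with hg
  have hgM : ∀ h, g h ≤ M := fun h => iSup₂_le fun x _ => hF _
  have hgsnoc : ∀ h a s, g (snocH h a s) ≤ g h := by
    intro h b s
    refine iSup₂_le fun x hx => ?_
    refine le_iSup₂_of_le x ⟨hx.1, ?_⟩ le_rfl
    have h2 := hx.2
    rw [lenH_snocH] at h2
    have h3 := congrArg (takeH (lenH h)) h2
    rwa [takeH_pref _ (Nat.le_succ _), takeH_snocH le_rfl, takeH_of_le le_rfl] at h3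
  have hmxg : mx i τ g ≤ g := by
    intro h
    refine iSup_le fun b => ?_
    refine (tr_mono _ (fun b s => hgsnoc h b s)).trans (tr_const _ (g h) h).le
  have hanti : Antitone (fun k => (mx i τ)^[k] g) := by
    refine antitone_nat_of_succ_le fun k => ?_
    rw [Function.iterate_succ_apply]
    exact (mx_mono i τ).iterate k hmxg
  set W : G.History → ℝ≥0∞ := fun h => ⨅ k, (mx i τ)^[k] g h with hW
  have hWg : ∀ h, W h ≤ g h := fun h => iInf_le (fun k => (mx i τ)^[k] g h) 0
  -- lower bound on `W h₀`
  have haW : a ≤ W h₀ := by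
    have hfar : ∀ N, lenH h₀ ≤ N → a ≤ (mx i τ)^[N - lenH h₀] g h₀ := by
      intro N hN
      refine ENNReal.le_of_forall_pos_le_add fun ε hε _ => ?_
      set U : Set (ℕ → ℕ) := {x | F (π x) < g (pref (π x) N) + ε} with hU
      have hUo : IsOpen U := by
        rw [isOpen_iff_mem_nhds]
        intro x hx
        filter_upwards [hπc N x, hπF.continuousAt.eventually (gt_mem_nhds hx)] with y hy1 hy2
        change F (π y) < g (pref (π y) N) + ε
        rw [hy1]
        exact hy2
      obtain ⟨k, hk⟩ := exists_box_subset n U hUo (by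
        intro x hx
        change F (π x) < g (pref (π x) N) + ε
        have h1 : F (π x) ≤ g (pref (π x) N) := by
          refine le_iSup₂_of_le x ⟨hx, ?_⟩ le_rfl
          rw [lenH_pref]
        refine lt_of_le_of_lt h1 (ENNReal.lt_add_right (ne_top_of_le_ne_top hM (hgM _)) ?_)
        simpa using hε.ne')
      have hex := exc_horizon i τ g N ε (R (B k).1) (by
        intro r
        by_cases hr : r ∈ π '' (B k).1
        · obtain ⟨x, hx, rfl⟩ := hr
          simp only [hR]
          rw [Set.indicator_of_mem (Set.mem_image_of_mem π hx)]
          rw [hB] at hx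
          exact (show F (π x) < g (pref (π x) N) + ε from hk x hx).le
        · simp [hR, Set.indicator_of_notMem hr])
      have h2 := ((B k).2.trans_le (outer_le hex h₀)).le
      rwa [takeH_of_le hN] at h2
    refine le_iInf fun k => ?_
    have := hfar (lenH h₀ + k) (by omega)
    rwa [Nat.add_sub_cancel_left] at this
  -- maximizing actions
  have hmax : ∀ h, ∃ b : G.ActionProfile,
      W h ≤ tr (Function.update (fun j => PMF.pure (b j)) i (τ h)) W h := by
    intro h
    by_contra hcon
    push Not at hcon
    have hlt : ∀ b : G.ActionProfile, ∃ k,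
        tr (Function.update (fun j => PMF.pure (b j)) i (τ h)) ((mx i τ)^[k] g) h < W h := by
      intro b
      have h1 := hcon b
      rw [hW, tr_iInf _ (fun k => (mx i τ)^[k] g) hanti] at h1
      · exact iInf_lt_iff.1 h1
      · refine ne_top_of_le_ne_top hM ?_
        exact (tr_mono _ fun b s => hgM _).trans (tr_const _ M h).le
    choose k hk using hlt
    set K := Finset.univ.sup k with hK
    have h2 : W h ≤ (mx i τ)^[K + 1] g h := iInf_le (fun k => (mx i τ)^[k] g h) (K + 1)
    rw [Function.iterate_succ_apply'] at h2
    obtain ⟨b, hb⟩ := exists_eq_ciSup_of_finite (f := fun b : G.ActionProfile =>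
      tr (Function.update (fun j => PMF.pure (b j)) i (τ h)) ((mx i τ)^[K] g) h)
    have h3 : mx i τ ((mx i τ)^[K] g) h
        = tr (Function.update (fun j => PMF.pure (b j)) i (τ h)) ((mx i τ)^[K] g) h := hb.symm
    rw [h3] at h2
    have h4 : tr (Function.update (fun j => PMF.pure (b j)) i (τ h)) ((mx i τ)^[K] g) h
        ≤ tr (Function.update (fun j => PMF.pure (b j)) i (τ h)) ((mx i τ)^[k b] g) h :=
      tr_mono _ fun _ _ => hanti (Finset.le_sup (f := k) (Finset.mem_univ b)) _
    exact absurd (h2.trans h4) (not_le.2 (hk b))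
  choose b hb using hmax
  refine ⟨fun j h => PMF.pure (b h j), haW.trans ?_⟩
  refine le_lintegral_of_sub hP h₀ _ W M hM (fun h => (hWg h).trans (hgM h)) ?_ F ?_
  · intro h
    refine (hb h).trans (le_of_eq ?_)
    unfold trS
    congr 1
    funext j
    by_cases hj : j = i
    · subst hj; simp
    · simp [Function.update_of_ne hj]
  · intro r
    refine le_of_forall_lt fun c hc => ?_
    obtain ⟨c', hcc', hc'l⟩ := exists_between hc
    have hc' : ∀ k, c' < g (pref r k) := by
      have hga : Antitone (fun k => g (pref r k)) := by
        refine antitone_nat_of_succ_le fun k => ?_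
        rw [pref_succ]
        exact hgsnoc _ _ _
      intro k
      have h1 := frequently_lt_of_lt_limsup (h := hc'l)
      obtain ⟨k', hk', h2⟩ := (h1.and_eventually (eventually_ge_atTop k)).exists
      exact hk'.trans_le ((hWg _).trans (hga h2))
    have hch : ∀ k, ∃ x : ℕ → ℕ, (∀ j, x j ≤ n j) ∧ pref (π x) k = pref r k ∧ c' < F (π x) := by
      intro k
      have h1 := hc' k
      simp only [hg, lt_iSup_iff, lenH_pref] at h1
      obtain ⟨x, hx, h2⟩ := h1
      exact ⟨x, hx.1, hx.2, h2⟩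
    choose x hxn hxp hxF using hch
    obtain ⟨w, hw, φ, hφ, hlim⟩ := (isCompact_box n).tendsto_subseq (x := x) hxn
    have hwr : π w = r := by
      apply run_eq_of_pref
      intro k
      obtain ⟨j, hj, hjk⟩ := ((hlim.eventually (hπc k w)).and (eventually_ge_atTop k)).exists
      rw [← hj]
      have h3 : k ≤ φ j := le_trans hjk (hφ.id_le j)
      have h4 := congrArg (takeH k) (hxp (φ j))
      rwa [takeH_pref _ h3, takeH_pref _ h3] at h4
    have h5 : c' ≤ F (π w) :=
      ge_of_tendsto ((hπF.tendsto w).comp hlim) (Eventually.of_forall fun j => (hxF (φ j)).le)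
    rw [hwr] at h5
    exact hcc'.trans_le h5
end Cap

theorem oneShotExp_eq (C : ℝ) (E : G.History → ℝ≥0∞) (M : ℝ≥0∞) (hM : M ≠ ⊤) (hE : ∀ h, E h ≤ M)
    (h : G.History) (x : ∀ j, PMF (G.A j)) :
    oneShotExp (fun h => C - (E h).toReal) h x = C - (tr x E h).toReal := by
  have hEt : ∀ h, E h ≠ ⊤ := fun h => ne_top_of_le_ne_top hM (hE h)
  have hin : ∀ a, ∑' s, G.trans (lastState h) a s * E (snocH h a s) ≠ ⊤ := by
    intro a
    refine ne_top_of_le_ne_top hM ?_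
    calc ∑' s, G.trans (lastState h) a s * E (snocH h a s)
        ≤ ∑' s, G.trans (lastState h) a s * M :=
          ENNReal.tsum_le_tsum fun s => mul_le_mul' le_rfl (hE _)
      _ = M := by rw [ENNReal.tsum_mul_right, PMF.tsum_coe, one_mul]
  have hprod : ∀ a : G.ActionProfile, ∏ j, x j (a j) ≠ ⊤ := fun a =>
    ENNReal.prod_ne_top fun j _ => PMF.apply_ne_top _ _
  have h1 : ∀ a, ∑' s, (G.trans (lastState h) a s).toReal * (C - (E (snocH h a s)).toReal)
      = C - (∑' s, G.trans (lastState h) a s * E (snocH h a s)).toReal := by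
    intro a
    have hs1 : Summable fun s => (G.trans (lastState h) a s).toReal :=
      ENNReal.summable_toReal (PMF.tsum_coe_ne_top _)
    have hs2 : Summable fun s => (G.trans (lastState h) a s * E (snocH h a s)).toReal :=
      ENNReal.summable_toReal (hin a)
    have ht : ∑' s, (G.trans (lastState h) a s).toReal = 1 := by
      rw [← ENNReal.tsum_toReal_eq (fun s => PMF.apply_ne_top _ _), PMF.tsum_coe]; rfl
    rw [ENNReal.tsum_toReal_eq (fun s => ENNReal.mul_ne_top (PMF.apply_ne_top _ _) (hEt _))]
    simp only [mul_sub]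
    have : ∀ s, (G.trans (lastState h) a s).toReal * (E (snocH h a s)).toReal
      = (G.trans (lastState h) a s * E (snocH h a s)).toReal := fun s => ENNReal.toReal_mul.symm
    simp only [this]
    rw [Summable.tsum_sub (hs1.mul_right C) hs2, tsum_mul_right, ht, one_mul]
  have h2 : ∑ a : G.ActionProfile, ∏ j, (x j (a j)).toReal = 1 := by
    have := congrArg ENNReal.toReal (sum_prod_pmf x)
    rw [ENNReal.toReal_sum (fun a _ => hprod a)] at this
    simpa [ENNReal.toReal_prod] using this
  unfold oneShotExp
  simp only [h1]
  rw [tr_eq_sum, ENNReal.toReal_sum (fun a _ => ENNReal.mul_ne_top (hprod a) (hin a))]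
  simp only [ENNReal.toReal_mul, ENNReal.toReal_prod, mul_sub]
  rw [Finset.sum_sub_distrib, ← Finset.sum_mul, h2, one_mul]

theorem validFrom_append (s : G.S) (l : List (G.ActionProfile × G.S)) (a : G.ActionProfile)
    (t : G.S) (h1 : ValidFrom G s l) (h2 : G.trans (lastState (s, l)) a t ≠ 0) :
    ValidFrom G s (l ++ [(a, t)]) := by
  induction l generalizing s with
  | nil => exact ⟨by simpa [lastState] using h2, trivial⟩
  | cons p l ih =>
    obtain ⟨b, u⟩ := p
    refine ⟨h1.1, ih u h1.2 ?_⟩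
    have : lastState ((u, l) : G.History) = lastState ((s, (b, u) :: l) : G.History) := by
      cases l with
      | nil => simp [lastState]
      | cons q l =>
        simp only [lastState, List.getLast?_cons_cons]
        rw [List.getLast?_eq_some_getLast (List.cons_ne_nil q l)]
        rfl
    rwa [this]

theorem valid_snocH {h : G.History} (hv : Valid h) {a : G.ActionProfile} {s : G.S}
    (hs : G.trans (lastState h) a s ≠ 0) : Valid (snocH h a s) :=
  validFrom_append h.1 h.2 a s hv hs

theorem ext_snocH {h' h : G.History} (hv : Ext h' h) (a : G.ActionProfile) (s : G.S) :
    Ext h' (snocH h a s) :=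
  ⟨hv.1, hv.2.trans (List.prefix_append _ _)⟩

section Fin
variable {P : G.History → G.Profile → Measure G.Run}

theorem expPay_eq (hP : IsInducedFamily G P) (i : G.I) (hfm : Measurable (G.payoff i)) (C : ℝ)
    (hC : ∀ r : G.Run, |G.payoff i r| ≤ C) (h : G.History) (σ : G.Profile) :
    expPay P h σ i = C - (∫⁻ r, ENNReal.ofReal (C - G.payoff i r) ∂(P h σ)).toReal := by
  have := hP.1 h σ
  have hpayInt : Integrable (G.payoff i) (P h σ) :=
    Integrable.of_bound hfm.aestronglyMeasurable C (Filter.Eventually.of_forall hC)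
  rw [← integral_eq_lintegral_of_nonneg_ae
    (Filter.Eventually.of_forall fun r => sub_nonneg.2 (le_of_abs_le (hC r)))
    (measurable_const.sub hfm).aestronglyMeasurable, integral_sub (integrable_const _) hpayInt]
  simp [expPay]

theorem lint_le (hP : IsInducedFamily G P) (i : G.I) (C : ℝ)
    (hC : ∀ r : G.Run, |G.payoff i r| ≤ C) (h : G.History) (σ : G.Profile) :
    ∫⁻ r, ENNReal.ofReal (C - G.payoff i r) ∂(P h σ) ≤ ENNReal.ofReal (2 * C) := by
  have := hP.1 h σ
  calc _ ≤ ∫⁻ r, ENNReal.ofReal (2 * C) ∂(P h σ) :=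
        lintegral_mono fun r => ENNReal.ofReal_le_ofReal (by linarith [neg_le_of_abs_le (hC r)])
    _ = _ := by simp

theorem abs_expPay_le (hP : IsInducedFamily G P) (i : G.I) (C : ℝ)
    (hC : ∀ r : G.Run, |G.payoff i r| ≤ C) (h : G.History) (σ : G.Profile) :
    |expPay P h σ i| ≤ C := by
  have := hP.1 h σ
  have := norm_integral_le_of_norm_le_const (μ := P h σ) (f := G.payoff i) (C := C)
    (Filter.Eventually.of_forall hC)
  simpa [expPay] using this

theorem exists_value (hP : IsInducedFamily G P) (i : G.I) (hfm : Measurable (G.payoff i)) (C : ℝ)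
    (hC : ∀ r : G.Run, |G.payoff i r| ≤ C) (δ : ℝ) (hδ : 0 < δ) (h : G.History) :
    ∃ V : G.History → ℝ≥0∞, (∀ g, ∃ y : PMF (G.A i), ∀ x : ∀ j, PMF (G.A j),
        tr (Function.update x i y) V g ≤ V g) ∧
      (∀ r, ENNReal.ofReal (C - G.payoff i r) ≤ liminf (fun k => V (pref r k)) atTop) ∧
      V h ≤ ENNReal.ofReal (C - maxminVal P i h) + ENNReal.ofReal δ ∧
      ∀ g, ENNReal.ofReal (C - maxminVal P i g) ≤ V g := by
  set F : G.Run → ℝ≥0∞ := fun r => ENNReal.ofReal (C - G.payoff i r) with hF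
  have hFm : Measurable F := (measurable_const.sub hfm).ennreal_ofReal
  have hFM : ∀ r, F r ≤ ENNReal.ofReal (2 * C) := fun r =>
    ENNReal.ofReal_le_ofReal (by linarith [neg_le_of_abs_le (hC r)])
  have : Nonempty G.Profile := ⟨fun j h => PMF.pure (Classical.arbitrary _)⟩
  have hbb : ∀ g (τ : G.Strategy i), BddBelow (Set.range fun σ : G.Profile =>
      expPay P g (Function.update σ i τ) i) := fun g τ =>
    ⟨-C, by rintro _ ⟨σ, rfl⟩; exact neg_le_of_abs_le (abs_expPay_le hP i C hC _ _)⟩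
  have hba : ∀ g, BddAbove (Set.range fun τ : G.Strategy i => ⨅ σ : G.Profile,
      expPay P g (Function.update σ i τ) i) := fun g =>
    ⟨C, by
      rintro _ ⟨τ, rfl⟩
      exact (ciInf_le (hbb g τ) (Classical.arbitrary _)).trans
        (le_of_abs_le (abs_expPay_le hP i C hC _ _))⟩
  have hmC : ∀ g, maxminVal P i g ≤ C := by
    intro g
    have : Nonempty (G.Strategy i) := ⟨fun h => PMF.pure (Classical.arbitrary _)⟩
    refine ciSup_le fun τ => ?_
    exact (ciInf_le (hbb g τ) (Classical.arbitrary _)).trans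
        (le_of_abs_le (abs_expPay_le hP i C hC _ _))
  obtain ⟨τ, hτ⟩ : ∃ τ : G.Strategy i, maxminVal P i h - δ / 2 <
      ⨅ σ : G.Profile, expPay P h (Function.update σ i τ) i := by
    have : Nonempty (G.Strategy i) := ⟨fun h => PMF.pure (Classical.arbitrary _)⟩
    exact exists_lt_of_lt_ciSup (by unfold maxminVal; linarith)
  have hout : outer i τ F h ≤ ENNReal.ofReal (C - maxminVal P i h + δ / 2) := by
    refine le_of_forall_lt fun a ha => ?_
    obtain ⟨a', haa, ha'⟩ := exists_between ha
    obtain ⟨σ, hσ⟩ := outer_le_cost hP i τ F hFm _ ENNReal.ofReal_ne_top hFM h a' ha'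
    refine haa.trans_le (hσ.trans ?_)
    have h1 := hτ.trans_le (ciInf_le (hbb h τ) σ)
    rw [expPay_eq hP i hfm C hC] at h1
    rw [← ENNReal.ofReal_toReal (ne_top_of_le_ne_top ENNReal.ofReal_ne_top
      (lint_le hP i C hC h (Function.update σ i τ)))]
    exact ENNReal.ofReal_le_ofReal (by linarith)
  obtain ⟨V, hV, hVh⟩ := exists_outer_lt (lt_of_le_of_lt hout
    (show _ < ENNReal.ofReal (C - maxminVal P i h) + ENNReal.ofReal δ by
      rw [← ENNReal.ofReal_add (by linarith [hmC h]) hδ.le]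
      exact (ENNReal.ofReal_lt_ofReal_iff (by linarith [hmC h])).2 (by linarith)))
  refine ⟨V, fun g => ⟨τ g, hV.1 g⟩, hV.2, hVh.le, fun g => ?_⟩
  by_cases htop : V g = ⊤
  · rw [htop]; exact le_top
  refine ENNReal.ofReal_le_of_le_toReal ?_
  have h2 : C - (V g).toReal ≤ ⨅ σ : G.Profile, expPay P g (Function.update σ i τ) i := by
    refine le_ciInf fun σ => ?_
    have hsup : ∀ g, trS (Function.update σ i τ) V g ≤ V g := by
      intro g
      refine le_of_eq_of_le ?_ (hV.1 g (fun j => σ j g))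
      unfold trS
      congr 1
      funext j
      by_cases hj : j = i
      · subst hj; simp
      · simp [Function.update_of_ne hj]
    have h3 := (lintegral_le_of_super hP g _ V hsup F hV.2).trans (hsup g)
    rw [expPay_eq hP i hfm C hC]
    have := ENNReal.toReal_mono htop h3
    linarith
  have h4 : _ ≤ maxminVal P i g := le_ciSup (hba g) τ
  linarith

/-- Part (3) in `ℝ≥0∞`. -/
theorem lintegral_le_tr (hP : IsInducedFamily G P) (F : G.Run → ℝ≥0∞) (E : G.History → ℝ≥0∞) (sw N : G.History → ℕ)
    (M η : ℝ≥0∞) (hM : M ≠ ⊤) (hE : ∀ h, E h ≤ M) (hη : η ≠ 0) (hη' : η ≠ ⊤)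
    (hN : ∀ h a s, N (snocH h a s) = N h + sw h)
    (hF : ∀ c : ℝ≥0∞, c ≠ 0 → ∀ r, F r ≤ liminf (fun k => E (pref r k) + c * N (pref r k)) atTop)
    (h' : G.History) (σ : G.Profile)
    (hσ : ∀ h, Valid h → Ext h' h → trS σ E h + sw h * η ≤ E h)
    (h : G.History) (hv : Valid h) (hx : Ext h' h) :
    ∫⁻ r, F r ∂(P h σ) ≤ trS σ E h := by
  have key : ∀ κ : ℝ≥0∞, κ ≠ 0 → κ ≠ ⊤ →
      ∫⁻ r, F r ∂(P h σ) ≤ trS σ E h + κ * (M + η * N h) := by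
    intro κ hκ hκ'
    set Y0 : G.History → ℝ≥0∞ := fun g => E g + κ * (E g + η * N g) with hY0
    set Y : G.History → ℝ≥0∞ := fun g => if Valid g ∧ Ext h' g then Y0 g else ⊤ with hY
    have hcomp : ∀ g, Valid g → Ext h' g →
        trS σ Y g = trS σ E g + κ * (trS σ E g + η * (N g + sw g : ℕ)) := by
      intro g hg hxg
      have e1 : trS σ Y g = trS σ (fun q => E q + κ * (E q + η * (N g + sw g : ℕ))) g := by
        unfold trS
        rw [tr_eq_tsum, tr_eq_tsum]
        refine tsum_congr fun p => ?_
        by_cases hp : G.trans (lastState g) p.1 p.2 = 0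
        · simp [wt, hp]
        · have : Valid (snocH g p.1 p.2) ∧ Ext h' (snocH g p.1 p.2) :=
            ⟨valid_snocH hg hp, ext_snocH hxg _ _⟩
          simp only [hY, if_pos this, hY0, hN]
      rw [e1]
      unfold trS
      rw [tr_add, tr_mul, tr_add, tr_const]
    have hadd : ∀ g, Valid g → Ext h' g →
        trS σ E g + η * (N g + sw g : ℕ) ≤ E g + η * N g := by
      intro g hg hxg
      refine le_of_eq_of_le ?_ (add_le_add (hσ g hg hxg) (le_refl (η * N g)))
      push_cast; ring
    have hsup : ∀ g, trS σ Y g ≤ Y g := by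
      intro g
      by_cases hg : Valid g ∧ Ext h' g
      · rw [hcomp g hg.1 hg.2]
        simp only [hY, if_pos hg, hY0]
        exact add_le_add (le_self_add.trans (hσ g hg.1 hg.2))
          (mul_le_mul' le_rfl (hadd g hg.1 hg.2))
      · simp only [hY, if_neg hg]; exact le_top
    have h1 := lintegral_le_of_super hP h σ Y hsup F (by
      intro r
      refine (hF (κ * η) (mul_ne_zero hκ hη) r).trans (liminf_le_liminf ?_)
      refine Eventually.of_forall fun k => ?_
      change _ ≤ Y (pref r k)
      by_cases hg : Valid (pref r k) ∧ Ext h' (pref r k)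
      · simp only [hY, if_pos hg, hY0]
        rw [mul_assoc]
        exact add_le_add le_rfl (mul_le_mul' le_rfl le_add_self)
      · simp only [hY, if_neg hg]; exact le_top)
    rw [hcomp h hv hx] at h1
    refine h1.trans (add_le_add le_rfl (mul_le_mul' le_rfl ((hadd h hv hx).trans ?_)))
    exact add_le_add (hE h) le_rfl
  set K : ℝ≥0∞ := M + η * N h with hK
  have hKt : K ≠ ⊤ := ENNReal.add_ne_top.2 ⟨hM, ENNReal.mul_ne_top hη' (ENNReal.natCast_ne_top _)⟩
  refine ENNReal.le_of_forall_pos_le_add fun ε hε _ => ?_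
  have hε' : (ε : ℝ≥0∞) ≠ 0 := by simpa using hε.ne'
  refine (key (ε / (K + 1)) ?_ ?_).trans (add_le_add le_rfl ?_)
  · exact ENNReal.div_ne_zero.2 ⟨hε', by simp [hKt]⟩
  · exact ENNReal.div_ne_top ENNReal.coe_ne_top (by simp)
  · calc ε / (K + 1) * K ≤ ε / (K + 1) * (K + 1) := mul_le_mul' le_rfl le_self_add
      _ ≤ ε := by rw [ENNReal.div_mul_cancel (by simp) (by simp [hKt])]

end Fin
end Aux

/-- **Theorem (Martin function for the maxmin value).**
In every stochastic game, for every `ε > 0` and every player `i`, there is a bounded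
function `D : H → ℝ` such that:
(1) `v̲_i(h) - ε ≤ D h ≤ v̲_i(h)` for every history `h`, where `v̲_i` is the maxmin value;
(2) `D h ≤ v̲_{O,i}(D, h)` for every history `h`;
(3) for every history `h'` and strategy profile `σ`, if
`v̲_{O,i}(D,h) ≤ E[D | h, σ(h)]` for every history `h` extending `h'` (including `h'`),
then `v̲_{O,i}(D,h) ≤ E_{h,σ}[f_i]` for every history `h` extending `h'` (including `h'`). -/
theorem exists_martin_function_maxmin (G : StochGame)
    (P : G.History → G.Profile → Measure G.Run) (hP : IsInducedFamily G P)
    (hfm : ∀ i, Measurable (G.payoff i))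
    (hfb : ∀ i, ∃ C : ℝ, ∀ r : G.Run, |G.payoff i r| ≤ C)
    (ε : ℝ) (hε : 0 < ε) (i : G.I) :
    ∃ D : G.History → ℝ,
      (∃ C : ℝ, ∀ h : G.History, |D h| ≤ C) ∧
      (∀ h : G.History, Valid h → maxminVal P i h - ε ≤ D h ∧ D h ≤ maxminVal P i h) ∧
      (∀ h : G.History, Valid h → D h ≤ oneShotMaxmin D i h) ∧
      (∀ h' : G.History, Valid h' → ∀ σ : G.Profile,
        (∀ h : G.History, Valid h → Ext h' h →
          oneShotMaxmin D i h ≤ oneShotExp D h (fun j => σ j h)) →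
        (∀ h : G.History, Valid h → Ext h' h →
          oneShotMaxmin D i h ≤ expPay P h σ i)) := by

  obtain ⟨C, hC⟩ := hfb i
  have hfmi := hfm i
  have hneP : Nonempty G.Profile := ⟨fun j h => PMF.pure (Classical.arbitrary _)⟩
  have hneS : Nonempty (G.Strategy i) := ⟨fun h => PMF.pure (Classical.arbitrary _)⟩
  have hneX : Nonempty (∀ j, PMF (G.A j)) := ⟨fun j => PMF.pure (Classical.arbitrary _)⟩
  have hneY : Nonempty (PMF (G.A i)) := ⟨PMF.pure (Classical.arbitrary _)⟩
  have hC0 : 0 ≤ C := by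
    have r : G.Run := (Classical.arbitrary _, fun _ => (fun _ => Classical.arbitrary _,
      Classical.arbitrary _))
    exact (abs_nonneg _).trans (hC r)
  have hinf : ∀ h (τ : G.Strategy i),
      |⨅ σ : G.Profile, expPay P h (Function.update σ i τ) i| ≤ C := by
    intro h τ
    have hb : BddBelow (Set.range fun σ : G.Profile => expPay P h (Function.update σ i τ) i) :=
      ⟨-C, by rintro _ ⟨σ, rfl⟩; exact neg_le_of_abs_le (abs_expPay_le hP i C hC _ _)⟩
    refine abs_le.2 ⟨le_ciInf fun σ => neg_le_of_abs_le (abs_expPay_le hP i C hC _ _), ?_⟩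
    exact (ciInf_le hb (Classical.arbitrary _)).trans
        (le_of_abs_le (abs_expPay_le hP i C hC _ _))
  have hval : ∀ h, |maxminVal P i h| ≤ C := by
    intro h
    have hb : BddAbove (Set.range fun τ : G.Strategy i =>
        ⨅ σ : G.Profile, expPay P h (Function.update σ i τ) i) :=
      ⟨C, by rintro _ ⟨τ, rfl⟩; exact le_of_abs_le (hinf h τ)⟩
    refine abs_le.2 ⟨?_, ciSup_le fun τ => le_of_abs_le (hinf h τ)⟩
    exact (neg_le_of_abs_le (hinf h (Classical.arbitrary _))).trans (le_ciSup hb _)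
  set F : G.Run → ℝ≥0∞ := fun r => ENNReal.ofReal (C - G.payoff i r) with hF
  set v : G.History → ℝ≥0∞ := fun h => ENNReal.ofReal (C - maxminVal P i h) with hv
  set η : ℝ≥0∞ := ENNReal.ofReal (ε / 4) with hη
  have hη0 : η ≠ 0 := by
    rw [hη]; simpa using hε
  have hηt : η ≠ ⊤ := ENNReal.ofReal_ne_top
  have h4η : 4 * η = ENNReal.ofReal ε := by
    rw [hη, show (4 : ℝ≥0∞) = ENNReal.ofReal 4 by simp, ← ENNReal.ofReal_mul (by norm_num)]
    congr 1; ring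
  obtain ⟨E, sw, N, hE, hN, hQE, hlim⟩ := glue
    (fun h U c => ∃ y : PMF (G.A i), ∀ x : ∀ j, PMF (G.A j), tr (Function.update x i y) U h ≤ c)
    (fun h U U' c hUU ⟨y, hy⟩ => ⟨y, fun x => (tr_mono _ hUU).trans (hy x)⟩)
    F v η hη0 (fun h => exists_value hP i hfmi C hC (ε / 4) (by linarith) h)
  set M : ℝ≥0∞ := ENNReal.ofReal (2 * C + ε) with hM
  have hMt : M ≠ ⊤ := ENNReal.ofReal_ne_top
  have hEub : ∀ h, E h ≤ ENNReal.ofReal (C - maxminVal P i h + ε) := by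
    intro h
    have := (hE h).2
    rwa [h4η, hv, ← ENNReal.ofReal_add (by linarith [le_of_abs_le (hval h)]) hε.le] at this
  have hEM : ∀ h, E h ≤ M := fun h => (hEub h).trans
    (ENNReal.ofReal_le_ofReal (by linarith [neg_le_of_abs_le (hval h)]))
  have hEt : ∀ h, E h ≠ ⊤ := fun h => ne_top_of_le_ne_top hMt (hEM h)
  have htrM : ∀ x h, tr x E h ≤ M := fun x h =>
    (tr_mono x fun a s => hEM _).trans (tr_const x M h).le
  have htrt : ∀ x h, tr x E h ≠ ⊤ := fun x h => ne_top_of_le_ne_top hMt (htrM x h)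
  have hD : ∀ h x, oneShotExp (fun h => C - (E h).toReal) h x = C - (tr x E h).toReal :=
    fun h x => oneShotExp_eq C E M hMt hEM h x
  have hEl : ∀ h, C - maxminVal P i h ≤ (E h).toReal := fun h =>
    (ENNReal.ofReal_le_iff_le_toReal (hEt h)).1 (hE h).1
  have hEu : ∀ h, (E h).toReal ≤ C - maxminVal P i h + ε := fun h =>
    ENNReal.toReal_le_of_le_ofReal (by linarith [le_of_abs_le (hval h)]) (hEub h)
  have hctr : ∀ h, ∃ c : ℝ≥0∞, c ≠ ⊤ ∧ c + sw h * η ≤ E h ∧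
      C - c.toReal ≤ oneShotMaxmin (fun h => C - (E h).toReal) i h := by
    intro h
    obtain ⟨c, ⟨y, hy⟩, hc⟩ := hQE h
    have hct : c ≠ ⊤ := ne_top_of_le_ne_top (hEt h) (le_self_add.trans hc)
    refine ⟨c, hct, hc, ?_⟩
    unfold oneShotMaxmin
    simp only [hD]
    have hbb : ∀ y : PMF (G.A i), BddBelow (Set.range fun x : ∀ j, PMF (G.A j) =>
        C - (tr (Function.update x i y) E h).toReal) := fun y =>
      ⟨C - M.toReal, by
        rintro _ ⟨x, rfl⟩
        exact sub_le_sub_left (ENNReal.toReal_mono hMt (htrM _ _)) _⟩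
    have hba : BddAbove (Set.range fun y : PMF (G.A i) => ⨅ x : ∀ j, PMF (G.A j),
        C - (tr (Function.update x i y) E h).toReal) :=
      ⟨C, by
        rintro _ ⟨y, rfl⟩
        exact (ciInf_le (hbb y) (Classical.arbitrary _)).trans
          (sub_le_self _ ENNReal.toReal_nonneg)⟩
    refine le_trans (le_ciInf fun x => ?_) (le_ciSup hba y)
    exact sub_le_sub_left (ENNReal.toReal_mono hct (hy x)) _
  refine ⟨fun h => C - (E h).toReal, ⟨C + ε, fun h => ?_⟩, fun h _ => ⟨?_, ?_⟩, fun h _ => ?_, ?_⟩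
  · have h1 := abs_le.1 (hval h)
    have h2 := hEl h
    have h3 := hEu h
    exact abs_le.2 ⟨by linarith, by linarith⟩
  · linarith [hEu h]
  · linarith [hEl h]
  · obtain ⟨c, hct, hc, h1⟩ := hctr h
    have := ENNReal.toReal_mono (hEt h) (le_self_add.trans hc)
    change C - (E h).toReal ≤ _
    linarith
  · intro h' _ σ hσ h hvh hx
    refine (hσ h hvh hx).trans ?_
    rw [hD, expPay_eq hP i hfmi C hC]
    refine sub_le_sub_left (ENNReal.toReal_mono (htrt _ _) ?_) _
    refine lintegral_le_tr hP F E sw N M η hMt hEM hη0 hηt hN hlim h' σ ?_ h hvh hx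
    intro g hg hxg
    obtain ⟨c, hct, hc, h1⟩ := hctr g
    refine le_trans (add_le_add ?_ le_rfl) hc
    have h2 := h1.trans (hσ g hg hxg)
    rw [hD] at h2
    exact (ENNReal.toReal_le_toReal (htrt _ _) hct).1 (by linarith)

end StochGame
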